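/- arXiv:2401.09816 — 2 statements merged into one kernel-verified Lean document; each statement's English description precedes it below -/
import Mathlib

section
/- Let X₁ and X₂ be independent, identically distributed nonnegative real random variables with common continuous cumulative distribution function F and E[X₁²] < ∞. Then ∫₀^∞ β_X(t) dF(t) = E[X₁²] − 2·E[X₁·X₂·1{X₁ > X₂}], where β_X(t) = ∫_t^∞ (x − t)² dF(x) = E[((X₁ − t)⁺)²] is the upper semivariance of X above the target value t. -/
open MeasureTheory ProbabilityTheory Set

lemma measure_singleton_eq_zero_of_continuous_cdf (ν : Measure ℝ) [IsProbabilityMeasure ν]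
    (h : Continuous fun t => cdf ν t) (a : ℝ) : ν {a} = 0 := by
  have hm := (cdf ν).measure_singleton a
  rw [measure_cdf, h.continuousAt.continuousWithinAt.leftLim_eq] at hm
  simpa using hm

lemma ae_fst_ne_snd_prod (ν : Measure ℝ) [SFinite ν] (h : ∀ a, ν {a} = 0) :
    ∀ᵐ z ∂(ν.prod ν), z.1 ≠ z.2 := by
  have hs : MeasurableSet {z : ℝ × ℝ | z.1 = z.2} :=
    measurableSet_eq_fun measurable_fst measurable_snd
  have hz : (ν.prod ν) {z : ℝ × ℝ | z.1 = z.2} = 0 := by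
    rw [Measure.measure_prod_null hs]
    filter_upwards with a
    have : Prod.mk a ⁻¹' {z : ℝ × ℝ | z.1 = z.2} = {a} := by
      ext b
      simp [eq_comm]
    rw [this, h a]
    rfl
  simpa [ae_iff] using hz

lemma integral_integral_upper_semivariance (ν : Measure ℝ) [IsProbabilityMeasure ν]
    (h : ∀ a, ν {a} = 0) (hint : Integrable (fun x => x ^ 2) ν) :
    ∫ t, (∫ x, (max (x - t) 0) ^ 2 ∂ν) ∂ν
      = ∫ x, x ^ 2 ∂ν
        - 2 * ∫ z, (if z.1 > z.2 then z.1 * z.2 else 0) ∂(ν.prod ν) := by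
  have h1 : Integrable (fun z : ℝ × ℝ => z.1 ^ 2) (ν.prod ν) := hint.comp_fst ν
  have h2 : Integrable (fun z : ℝ × ℝ => z.2 ^ 2) (ν.prod ν) := hint.comp_snd ν
  have h12 : Integrable (fun z : ℝ × ℝ => z.1 ^ 2 + z.2 ^ 2) (ν.prod ν) := h1.add h2
  have hxy : Integrable (fun z : ℝ × ℝ => z.1 * z.2) (ν.prod ν) := by
    refine h12.mono' (by fun_prop) (.of_forall fun z => ?_)
    rw [Real.norm_eq_abs, abs_le]
    constructor <;> nlinarith [sq_nonneg (z.1 + z.2), sq_nonneg (z.1 - z.2)]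
  have hg : Integrable (fun z : ℝ × ℝ => (max (z.2 - z.1) 0) ^ 2) (ν.prod ν) := by
    refine (h12.const_mul 2).mono' (by fun_prop) (.of_forall fun z => ?_)
    rw [Real.norm_eq_abs, abs_of_nonneg (sq_nonneg _)]
    rcases max_cases (z.2 - z.1) 0 with ⟨e, -⟩ | ⟨e, -⟩ <;> rw [e] <;>
      nlinarith [sq_nonneg (z.1 + z.2), sq_nonneg z.1, sq_nonneg z.2]
  have hh : Integrable (fun z : ℝ × ℝ => if z.1 > z.2 then z.1 * z.2 else 0) (ν.prod ν) :=
    hxy.indicator (measurableSet_lt measurable_snd measurable_fst)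
  have hg_swap : Integrable (fun z : ℝ × ℝ => (max (z.1 - z.2) 0) ^ 2) (ν.prod ν) := hg.swap
  have hh_swap : Integrable (fun z : ℝ × ℝ => if z.2 > z.1 then z.2 * z.1 else 0) (ν.prod ν) :=
    hh.swap
  have hgs : ∫ z : ℝ × ℝ, (max (z.1 - z.2) 0) ^ 2 ∂(ν.prod ν)
      = ∫ z : ℝ × ℝ, (max (z.2 - z.1) 0) ^ 2 ∂(ν.prod ν) :=
    integral_prod_swap (fun z : ℝ × ℝ => (max (z.2 - z.1) 0) ^ 2)
  have hhs : ∫ z : ℝ × ℝ, (if z.2 > z.1 then z.2 * z.1 else 0) ∂(ν.prod ν)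
      = ∫ z : ℝ × ℝ, (if z.1 > z.2 then z.1 * z.2 else 0) ∂(ν.prod ν) :=
    integral_prod_swap (fun z : ℝ × ℝ => if z.1 > z.2 then z.1 * z.2 else 0)
  have hsum_g : ∫ z : ℝ × ℝ, (max (z.2 - z.1) 0) ^ 2 ∂(ν.prod ν)
      + ∫ z : ℝ × ℝ, (max (z.1 - z.2) 0) ^ 2 ∂(ν.prod ν)
      = ∫ z : ℝ × ℝ, z.1 ^ 2 ∂(ν.prod ν) + ∫ z : ℝ × ℝ, z.2 ^ 2 ∂(ν.prod ν)
        - 2 * ∫ z : ℝ × ℝ, z.1 * z.2 ∂(ν.prod ν) := by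
    rw [← integral_add hg hg_swap, ← integral_add h1 h2, ← integral_const_mul,
      ← integral_sub h12 (hxy.const_mul 2)]
    refine integral_congr_ae (.of_forall fun z => ?_)
    dsimp only
    rcases le_total z.1 z.2 with hle | hle
    · rw [max_eq_left (sub_nonneg.2 hle), max_eq_right (sub_nonpos.2 hle)]
      ring
    · rw [max_eq_right (sub_nonpos.2 hle), max_eq_left (sub_nonneg.2 hle)]
      ring
  have hsum_h : ∫ z : ℝ × ℝ, (if z.1 > z.2 then z.1 * z.2 else 0) ∂(ν.prod ν)
      + ∫ z : ℝ × ℝ, (if z.2 > z.1 then z.2 * z.1 else 0) ∂(ν.prod ν)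
      = ∫ z : ℝ × ℝ, z.1 * z.2 ∂(ν.prod ν) := by
    rw [← integral_add hh hh_swap]
    refine integral_congr_ae ?_
    filter_upwards [ae_fst_ne_snd_prod ν h] with z hz
    rcases lt_or_gt_of_ne hz with hlt | hlt
    · simp [hlt, hlt.not_gt, mul_comm]
    · simp [hlt, hlt.not_gt]
  have hfst : ∫ z : ℝ × ℝ, z.1 ^ 2 ∂(ν.prod ν) = ∫ x, x ^ 2 ∂ν := by
    simpa using integral_fun_fst (μ := ν) (ν := ν) (fun x : ℝ => x ^ 2)
  have hsnd : ∫ z : ℝ × ℝ, z.2 ^ 2 ∂(ν.prod ν) = ∫ x, x ^ 2 ∂ν := by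
    simpa using integral_fun_snd (μ := ν) (ν := ν) (fun x : ℝ => x ^ 2)
  rw [← integral_prod _ hg]
  linarith

/-- For i.i.d. nonnegative random variables `X₁, X₂` with common continuous
CDF and finite second moment, `∫₀^∞ β_X(t) dF(t) = E[X₁²] - 2 E[X₁ X₂ 1{X₁ > X₂}]`, where
`β_X(t) = E[((X₁ - t)⁺)²]` is the upper semivariance above the target `t` and the outer
integral is with respect to the distribution `F` of `X₁`. -/
theorem jel_semivariance_Delta1 {Ω : Type*} [MeasurableSpace Ω] (μ : Measure Ω)
    [IsProbabilityMeasure μ] (X₁ X₂ : Ω → ℝ)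
    (hX₁ : Measurable X₁) (hX₂ : Measurable X₂)
    (hpos₁ : ∀ ω, 0 ≤ X₁ ω) (hpos₂ : ∀ ω, 0 ≤ X₂ ω)
    (hid : IdentDistrib X₁ X₂ μ μ)
    (hind : IndepFun X₁ X₂ μ)
    (hcont : Continuous fun t => (μ {ω | X₁ ω ≤ t}).toReal)
    (hint : Integrable (fun ω => (X₁ ω) ^ 2) μ) :
    ∫ t, (∫ ω, (max (X₁ ω - t) 0) ^ 2 ∂μ) ∂(μ.map X₁)
      = ∫ ω, (X₁ ω) ^ 2 ∂μ
        - 2 * ∫ ω, (if X₁ ω > X₂ ω then X₁ ω * X₂ ω else 0) ∂μ := by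
  have : IsProbabilityMeasure (μ.map X₁) := Measure.isProbabilityMeasure_map hX₁.aemeasurable
  have hcdf : Continuous fun t => cdf (μ.map X₁) t := by
    convert hcont using 2 with t
    rw [cdf_eq_real, measureReal_def, Measure.map_apply hX₁ measurableSet_Iic]
    rfl
  have hprod : μ.map (fun ω => (X₁ ω, X₂ ω)) = (μ.map X₁).prod (μ.map X₁) := by
    rw [(indepFun_iff_map_prod_eq_prod_map_map hX₁.aemeasurable hX₂.aemeasurable).1 hind,
      ← hid.map_eq]
  have hsq : Integrable (fun x : ℝ => x ^ 2) (μ.map X₁) :=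
    (integrable_map_measure (by fun_prop) hX₁.aemeasurable).2 hint
  have key := integral_integral_upper_semivariance (μ.map X₁)
    (measure_singleton_eq_zero_of_continuous_cdf _ hcdf) hsq
  have hmeas : Measurable fun z : ℝ × ℝ => if z.1 > z.2 then z.1 * z.2 else 0 :=
    Measurable.ite (measurableSet_lt measurable_snd measurable_fst) (by fun_prop) (by fun_prop)
  rw [← hprod, integral_map (hX₁.prodMk hX₂).aemeasurable hmeas.aestronglyMeasurable,
    integral_map (f := fun x : ℝ => x ^ 2) hX₁.aemeasurable (by fun_prop)] at key
  rw [← key]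
  congr 1
  ext t
  exact (integral_map (f := fun x : ℝ => (max (x - t) 0) ^ 2) hX₁.aemeasurable
    (by fun_prop)).symm
end

section
/- Let X and Y be independent nonnegative real random variables with continuous cumulative distribution functions F and G respectively, with E[X²] < ∞ and E[Y²] < ∞. Then ∫₀^∞ β_X(t) dG(t) = E[X²·1{X > Y}] + E[Y²] − E[Y²·1{Y > X}] − 2·E[X·Y·1{X > Y}], where β_X(t) = E[((X − t)⁺)²] is the upper semivariance of X above the target value t. -/
open MeasureTheory ProbabilityTheory Set

/-- A random variable with a continuous cumulative distribution function has an atomless law. -/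
theorem nullSingleton_map_of_continuous_cdf {Ω : Type*} [MeasurableSpace Ω] {μ : Measure Ω}
    [IsProbabilityMeasure μ] {X : Ω → ℝ} (hX : Measurable X)
    (hcont : Continuous fun t => (μ {ω | X ω ≤ t}).toReal) (a : ℝ) :
    μ.map X {a} = 0 := by
  have : IsProbabilityMeasure (μ.map X) := Measure.isProbabilityMeasure_map hX.aemeasurable
  have hcdf : (cdf (μ.map X) : ℝ → ℝ) = fun t => (μ {ω | X ω ≤ t}).toReal := by
    ext t
    rw [cdf_eq_real, measureReal_def, Measure.map_apply hX measurableSet_Iic]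
    rfl
  rw [← measure_cdf (μ.map X), StieltjesFunction.measure_singleton, hcdf,
    hcont.continuousAt.continuousWithinAt.leftLim_eq, sub_self, ENNReal.ofReal_zero]

/-- Independent random variables, the first of which has an atomless law, almost surely differ. -/
theorem ae_ne_of_indepFun {Ω : Type*} [MeasurableSpace Ω] {μ : Measure Ω}
    [IsProbabilityMeasure μ] {X Y : Ω → ℝ} (hX : Measurable X) (hY : Measurable Y)
    (hind : IndepFun X Y μ) (hatom : ∀ a, μ.map X {a} = 0) :
    ∀ᵐ ω ∂μ, X ω ≠ Y ω := by
  have : IsProbabilityMeasure (μ.map X) := Measure.isProbabilityMeasure_map hX.aemeasurable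
  have : IsProbabilityMeasure (μ.map Y) := Measure.isProbabilityMeasure_map hY.aemeasurable
  have hdiag : MeasurableSet {p : ℝ × ℝ | p.1 = p.2} :=
    measurableSet_eq_fun measurable_fst measurable_snd
  have hnull : μ.map (fun ω => (X ω, Y ω)) {p : ℝ × ℝ | p.1 = p.2} = 0 := by
    rw [(indepFun_iff_map_prod_eq_prod_map_map hX.aemeasurable hY.aemeasurable).1 hind,
      Measure.prod_apply_symm hdiag]
    simp [hatom]
  rw [Measure.map_apply (hX.prodMk hY) hdiag] at hnull
  rw [ae_iff]
  simpa using hnull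

/-- For independent nonnegative random variables `X ~ F` and `Y ~ G` with
continuous CDFs and finite second moments,
`∫₀^∞ β_X(t) dG(t) = E[X² 1{X > Y}] + E[Y²] - E[Y² 1{Y > X}] - 2 E[X Y 1{X > Y}]`,
where `β_X(t) = E[((X - t)⁺)²]` is the upper semivariance of `X` above the target `t`. -/
theorem jel_semivariance_Delta2 {Ω : Type*} [MeasurableSpace Ω] (μ : Measure Ω)
    [IsProbabilityMeasure μ] (X Y : Ω → ℝ)
    (hX : Measurable X) (hY : Measurable Y)
    (hposX : ∀ ω, 0 ≤ X ω) (hposY : ∀ ω, 0 ≤ Y ω)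
    (hind : IndepFun X Y μ)
    (hcontF : Continuous fun t => (μ {ω | X ω ≤ t}).toReal)
    (hcontG : Continuous fun t => (μ {ω | Y ω ≤ t}).toReal)
    (hintX : Integrable (fun ω => (X ω) ^ 2) μ)
    (hintY : Integrable (fun ω => (Y ω) ^ 2) μ) :
    ∫ t, (∫ ω, (max (X ω - t) 0) ^ 2 ∂μ) ∂(μ.map Y)
      = (∫ ω, (if X ω > Y ω then (X ω) ^ 2 else 0) ∂μ)
        + (∫ ω, (Y ω) ^ 2 ∂μ)
        - (∫ ω, (if Y ω > X ω then (Y ω) ^ 2 else 0) ∂μ)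
        - 2 * ∫ ω, (if X ω > Y ω then X ω * Y ω else 0) ∂μ := by
  have : IsProbabilityMeasure (μ.map X) := Measure.isProbabilityMeasure_map hX.aemeasurable
  have : IsProbabilityMeasure (μ.map Y) := Measure.isProbabilityMeasure_map hY.aemeasurable
  have hne := ae_ne_of_indepFun hX hY hind (nullSingleton_map_of_continuous_cdf hX hcontF)
  have hlt : MeasurableSet {ω | Y ω < X ω} := measurableSet_lt hY hX
  have hgt : MeasurableSet {ω | X ω < Y ω} := measurableSet_lt hX hY
  have hXY : Integrable (fun ω => X ω * Y ω) μ := by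
    refine (hintX.add hintY).mono' (hX.mul hY).aestronglyMeasurable (ae_of_all _ fun ω => ?_)
    rw [Real.norm_of_nonneg (mul_nonneg (hposX ω) (hposY ω))]
    simp only [Pi.add_apply]
    nlinarith [sq_nonneg (X ω - Y ω), sq_nonneg (X ω), sq_nonneg (Y ω)]
  have h₁ : Integrable (fun ω => if X ω > Y ω then (X ω) ^ 2 else 0) μ :=
    hintX.indicator hlt
  have h₂ : Integrable (fun ω => if Y ω > X ω then (Y ω) ^ 2 else 0) μ :=
    hintY.indicator hgt
  have h₃ : Integrable (fun ω => if X ω > Y ω then X ω * Y ω else 0) μ :=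
    hXY.indicator hlt
  have hf : Measurable fun p : ℝ × ℝ => (max (p.1 - p.2) 0) ^ 2 := by fun_prop
  have hmap := (indepFun_iff_map_prod_eq_prod_map_map hX.aemeasurable hY.aemeasurable).1 hind
  have hsq : Integrable (fun ω => (max (X ω - Y ω) 0) ^ 2) μ := by
    refine hintX.mono' (hf.comp (hX.prodMk hY)).aestronglyMeasurable (ae_of_all _ fun ω => ?_)
    rw [Real.norm_of_nonneg (sq_nonneg _)]
    exact pow_le_pow_left₀ (le_max_right _ _)
      (max_le (sub_le_self _ (hposY ω)) (hposX ω)) 2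
  have hprod : Integrable (fun p : ℝ × ℝ => (max (p.1 - p.2) 0) ^ 2)
      ((μ.map X).prod (μ.map Y)) := by
    rw [← hmap]
    exact (integrable_map_measure hf.aestronglyMeasurable (hX.prodMk hY).aemeasurable).2 hsq
  have hleft : ∫ t, (∫ ω, (max (X ω - t) 0) ^ 2 ∂μ) ∂(μ.map Y)
      = ∫ ω, (max (X ω - Y ω) 0) ^ 2 ∂μ := by
    rw [← integral_map (hX.prodMk hY).aemeasurable hf.aestronglyMeasurable, hmap,
      integral_prod_symm _ hprod]
    refine integral_congr_ae (ae_of_all _ fun t => ?_)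
    have ht : Measurable fun x : ℝ => (max (x - t) 0) ^ 2 := by fun_prop
    exact (integral_map hX.aemeasurable ht.aestronglyMeasurable).symm
  have h₄ : Integrable (fun ω => (if X ω > Y ω then (X ω) ^ 2 else 0) + (Y ω) ^ 2) μ :=
    h₁.add hintY
  have h₅ : Integrable (fun ω => (if X ω > Y ω then (X ω) ^ 2 else 0) + (Y ω) ^ 2
      - if Y ω > X ω then (Y ω) ^ 2 else 0) μ :=
    h₄.sub h₂
  rw [hleft, ← integral_add h₁ hintY, ← integral_sub h₄ h₂, ← integral_const_mul,
    ← integral_sub h₅ (h₃.const_mul 2)]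
  refine integral_congr_ae ?_
  filter_upwards [hne] with ω hω
  rcases lt_or_gt_of_ne hω with h | h
  · simp [h, h.le, not_lt_of_gt h]
  · simp only [gt_iff_lt, h, if_true, not_lt_of_gt h, if_false, max_eq_left (sub_nonneg.2 h.le)]
    ring
end
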